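/- arXiv:2105.04156 — 2 statements merged into one kernel-verified Lean document; each statement's English description precedes it below -/
import Mathlib

section
/- Let u : ℝ → ℝ be three times continuously differentiable on [0,1]. Suppose there exists a sequence of real numbers (μ_ℓ)_{ℓ ≥ 1} such that for every x ∈ [0,1] the series Σ_{ℓ=1}^{∞} μ_ℓ g_ℓ(x) converges and u(x) = u(0)(1 − x) + u(1)x + Σ_{ℓ=1}^{∞} μ_ℓ g_ℓ(x). Then u is a quadratic function on [0,1]: there exist real numbers a, b, c such that u(x) = a x² + b x + c for all x ∈ [0,1]. -/
/-- The hat function `g`. -/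
noncomputable def hatg (x : ℝ) : ℝ :=
  if 0 ≤ x ∧ x ≤ 1/2 then 2*x
  else if 1/2 < x ∧ x ≤ 1 then 2*(1-x)
  else 0

open Set Filter Topology

theorem hatg_of_le_half {x : ℝ} (h0 : 0 ≤ x) (h1 : x ≤ 1 / 2) :
    hatg x = 2 * x := by
  rw [hatg, if_pos ⟨h0, h1⟩]

theorem hatg_of_half_le {x : ℝ} (h0 : 1 / 2 ≤ x) (h1 : x ≤ 1) :
    hatg x = 2 * (1 - x) := by
  rcases h0.eq_or_lt with rfl | h
  · rw [hatg_of_le_half (by norm_num) le_rfl]; norm_num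
  · rw [hatg, if_neg (fun h' => absurd h'.2 (not_le.mpr h)), if_pos ⟨h, h1⟩]

theorem hatg_iterate_zero (n : ℕ) : hatg^[n] 0 = 0 :=
  Function.iterate_fixed (by rw [hatg_of_le_half le_rfl (by norm_num), mul_zero]) n

/-- The second difference of `g_{ℓ+1}` over the dyadic interval `[j / 2 ^ k, (j + 1) / 2 ^ k]`
does not depend on `j`. -/
theorem hatg_iterate_second_difference (k ℓ j : ℕ) (hj : j < 2 ^ k) :
    hatg^[ℓ + 1] ((j : ℝ) / 2 ^ k) + hatg^[ℓ + 1] (((j : ℝ) + 1) / 2 ^ k)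
      - 2 * hatg^[ℓ + 1] (((j : ℝ) + 1 / 2) / 2 ^ k) = if ℓ = k then -2 else 0 := by
  induction k generalizing ℓ j with
  | zero =>
    obtain rfl : j = 0 := by simpa using hj
    have e0 : hatg 0 = 0 := hatg_iterate_zero 1
    have e1 : hatg 1 = 0 := by rw [hatg_of_half_le (by norm_num) le_rfl]; norm_num
    have e2 : hatg (1 / 2) = 1 := by rw [hatg_of_le_half (by norm_num) le_rfl]; norm_num
    rcases ℓ with _ | ℓ
    · simp only [Nat.cast_zero, pow_zero, div_one, zero_add, Function.iterate_one, e0, e1, e2]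
      norm_num
    · simp only [Nat.cast_zero, pow_zero, div_one, zero_add, Function.iterate_succ_apply, e0, e1,
        e2, hatg_iterate_zero]
      simp
  | succ k ih =>
    have hp : (0 : ℝ) < 2 ^ k := by positivity
    have hj0 : (0 : ℝ) ≤ j := j.cast_nonneg
    have hpow : (2 : ℝ) ^ (k + 1) = 2 * 2 ^ k := by ring
    rcases lt_or_ge j (2 ^ k) with h | h
    · have h' : (j : ℝ) + 1 ≤ 2 ^ k := by exact_mod_cast h
      have key : ∀ t : ℝ, 0 ≤ t → t ≤ 2 ^ k → hatg (t / 2 ^ (k + 1)) = t / 2 ^ k := by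
        intro t h0 h1
        rw [hatg_of_le_half (by positivity) (by rw [div_le_iff₀ (by positivity)]; linarith), hpow]
        field_simp
      simp only [Function.iterate_succ_apply]
      rw [key _ hj0 (by linarith), key _ (by linarith) h', key _ (by linarith) (by linarith)]
      rcases ℓ with _ | ℓ
      · simp only [Function.iterate_zero, id]
        rw [if_neg (by omega)]
        ring
      · rw [ih ℓ j h]
        simp
    · obtain ⟨i, hi⟩ : ∃ i, i + 1 + j = 2 ^ (k + 1) := ⟨2 ^ (k + 1) - 1 - j, by omega⟩
      have hi' : (i : ℝ) + 1 + j = 2 * 2 ^ k := by rw [← hpow]; exact_mod_cast hi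
      have h' : (2 : ℝ) ^ k ≤ j := by exact_mod_cast h
      have hik : i < 2 ^ k := by rw [pow_succ] at hi; omega
      have hi0 : (0 : ℝ) ≤ i := i.cast_nonneg
      have key : ∀ t : ℝ, 2 ^ k ≤ t → t ≤ 2 * 2 ^ k →
          hatg (t / 2 ^ (k + 1)) = (2 * 2 ^ k - t) / 2 ^ k := by
        intro t h0 h1
        rw [hatg_of_half_le (by rw [le_div_iff₀ (by positivity)]; linarith)
          (by rw [div_le_iff₀ (by positivity)]; linarith), hpow]
        field_simp
      simp only [Function.iterate_succ_apply]
      rw [key _ h' (by linarith), key _ (by linarith) (by linarith),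
        key _ (by linarith) (by linarith), ← hi',
        show (i : ℝ) + 1 + j - j = i + 1 by ring, show (i : ℝ) + 1 + j - (j + 1) = i by ring,
        show (i : ℝ) + 1 + j - (j + 1 / 2) = i + 1 / 2 by ring]
      rcases ℓ with _ | ℓ
      · simp only [Function.iterate_zero, id]
        rw [if_neg (by omega)]
        ring
      · have := ih ℓ i hik
        simp only [add_left_inj]
        rw [← this]
        ring

/-- Mean value theorem for second differences. -/
theorem exists_second_difference_eq {f f' f'' : ℝ → ℝ} {a h : ℝ} (hh : 0 < h)
    (hf : ContinuousOn f (Icc a (a + 2 * h)))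
    (hf' : ∀ x ∈ Ioo a (a + 2 * h), HasDerivAt f (f' x) x)
    (hf'' : ∀ x ∈ Ioo a (a + 2 * h), HasDerivAt f' (f'' x) x) :
    ∃ ξ ∈ Ioo a (a + 2 * h), f a + f (a + 2 * h) - 2 * f (a + h) = f'' ξ * h ^ 2 := by
  obtain ⟨t, ht, hteq⟩ := exists_hasDerivAt_eq_slope (fun x => f (x + h) - f x)
    (fun x => f' (x + h) - f' x) (show a < a + h by linarith)
    (by
      refine ContinuousOn.sub (hf.comp (by fun_prop) ?_) (hf.mono ?_)
      · rintro x ⟨h1, h2⟩; constructor <;> linarith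
      · rintro x ⟨h1, h2⟩; constructor <;> linarith)
    (by
      rintro x ⟨h1, h2⟩
      exact ((hf' (x + h) ⟨by linarith, by linarith⟩).comp_add_const x h).sub
        (hf' x ⟨by linarith, by linarith⟩))
  obtain ⟨ht1, ht2⟩ := ht
  have hd : ∀ x ∈ Icc t (t + h), HasDerivAt f' (f'' x) x := fun x hx =>
    hf'' x ⟨by linarith [hx.1], by linarith [hx.2]⟩
  obtain ⟨ξ, hξ, hξeq⟩ := exists_hasDerivAt_eq_slope f' f'' (show t < t + h by linarith)
    (fun x hx => (hd x hx).continuousAt.continuousWithinAt)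
    (fun x hx => hd x (Ioo_subset_Icc_self hx))
  refine ⟨ξ, ⟨by linarith [hξ.1], by linarith [hξ.2]⟩, ?_⟩
  rw [add_sub_cancel_left, eq_div_iff hh.ne'] at hteq hξeq
  rw [show a + h + h = a + 2 * h by ring] at hteq
  linear_combination -hteq - h * hξeq

/-- A function on `[0, 1]` whose second derivative is a constant `c` is quadratic. -/
theorem quadratic_of_second_derivative_const {f f' f'' : ℝ → ℝ} {c : ℝ}
    (hf' : ∀ x ∈ Icc (0 : ℝ) 1, HasDerivWithinAt f (f' x) (Icc 0 1) x)
    (hf'' : ∀ x ∈ Icc (0 : ℝ) 1, HasDerivWithinAt f' (f'' x) (Icc 0 1) x)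
    (hc : ∀ x ∈ Ico (0 : ℝ) 1, f'' x = c) :
    ∀ x ∈ Icc (0 : ℝ) 1, f x = c / 2 * x ^ 2 + f' 0 * x + f 0 := by
  have hud : ∀ x ∈ Icc (0 : ℝ) 1, UniqueDiffWithinAt ℝ (Icc (0 : ℝ) 1) x :=
    uniqueDiffOn_Icc zero_lt_one
  have h1 : ∀ x ∈ Icc (0 : ℝ) 1, f' x = c * x + f' 0 := by
    have hd : ∀ x ∈ Icc (0 : ℝ) 1,
        HasDerivWithinAt (fun x => f' x - c * x) (f'' x - c * 1) (Icc 0 1) x := fun x hx =>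
      (hf'' x hx).sub ((hasDerivWithinAt_id x _).const_mul c)
    intro x hx
    have := constant_of_derivWithin_zero (fun y hy => (hd y hy).differentiableWithinAt)
      (fun y hy => by
        rw [(hd y (Ico_subset_Icc_self hy)).derivWithin (hud y (Ico_subset_Icc_self hy)), hc y hy]
        ring) x hx
    linarith
  have hd : ∀ x ∈ Icc (0 : ℝ) 1, HasDerivWithinAt (fun x => f x - (c / 2 * x ^ 2 + f' 0 * x))
      (f' x - (c / 2 * (2 * x) + f' 0 * 1)) (Icc 0 1) x := by
    intro x hx
    refine (hf' x hx).sub (HasDerivWithinAt.add (HasDerivWithinAt.const_mul _ ?_)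
      ((hasDerivWithinAt_id x _).const_mul _))
    simpa using (hasDerivAt_pow 2 x).hasDerivWithinAt
  intro x hx
  have := constant_of_derivWithin_zero (fun y hy => (hd y hy).differentiableWithinAt)
    (fun y hy => by
      rw [(hd y (Ico_subset_Icc_self hy)).derivWithin (hud y (Ico_subset_Icc_self hy)),
        h1 y (Ico_subset_Icc_self hy)]
      ring) x hx
  linarith

/-- If `u` is three times continuously differentiable on `[0,1]` and
`u(x) = u(0)(1−x) + u(1)x + Σ_{ℓ=1}^∞ μ_ℓ g_ℓ(x)` (with the series converging) for all
`x ∈ [0,1]`, then `u` is a quadratic function on `[0,1]`.  Here `μ ℓ` stands for `μ_{ℓ+1}`,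
and `hatg^[ℓ+1]` is `g_{ℓ+1}`. -/
theorem stmt6 (u : ℝ → ℝ) (hu : ContDiffOn ℝ 3 u (Set.Icc (0:ℝ) 1))
    (μ : ℕ → ℝ)
    (hsum : ∀ x ∈ Set.Icc (0:ℝ) 1,
      HasSum (fun ℓ : ℕ => μ ℓ * hatg^[ℓ+1] x) (u x - (u 0 * (1 - x) + u 1 * x))) :
    ∃ a b c : ℝ, ∀ x ∈ Set.Icc (0:ℝ) 1, u x = a * x^2 + b * x + c := by
  have hdiff : ∀ k j : ℕ, j < 2 ^ k →
      u ((j : ℝ) / 2 ^ k) + u (((j : ℝ) + 1) / 2 ^ k) - 2 * u (((j : ℝ) + 1 / 2) / 2 ^ k)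
        = -2 * μ k := by
    intro k j hj
    have hj' : (j : ℝ) + 1 ≤ 2 ^ k := by exact_mod_cast hj
    have hj0 : (0 : ℝ) ≤ j := j.cast_nonneg
    have hmem : ∀ t : ℝ, 0 ≤ t → t ≤ 2 ^ k → t / 2 ^ k ∈ Icc (0 : ℝ) 1 := fun t h0 h1 =>
      ⟨by positivity, div_le_one_of_le₀ h1 (by positivity)⟩
    have hs := ((hsum _ (hmem j hj0 (by linarith))).add
      (hsum _ (hmem (j + 1) (by linarith) hj'))).sub
      ((hsum _ (hmem (j + 1 / 2) (by linarith) (by linarith))).mul_left 2)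
    have hs' : HasSum (fun ℓ : ℕ => if ℓ = k then -2 * μ k else 0) (-2 * μ k) :=
      hasSum_ite_eq k _
    have := hs.unique (hs'.congr_fun fun ℓ => by
      have := hatg_iterate_second_difference k ℓ j hj
      split_ifs at this ⊢ with h
      · subst h; linear_combination μ ℓ * this
      · linear_combination μ ℓ * this)
    linear_combination this
  have hud : UniqueDiffOn ℝ (Icc (0 : ℝ) 1) := uniqueDiffOn_Icc zero_lt_one
  set u' := derivWithin u (Icc 0 1) with hu'
  set u'' := derivWithin u' (Icc 0 1) with hu''
  have hcu' : ContDiffOn ℝ 2 u' (Icc 0 1) := hu.derivWithin hud (by norm_num)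
  have hcu'' : ContDiffOn ℝ 1 u'' (Icc 0 1) := hcu'.derivWithin hud (by norm_num)
  have hd' : ∀ x ∈ Icc (0 : ℝ) 1, HasDerivWithinAt u (u' x) (Icc 0 1) x := fun x hx =>
    (hu.differentiableOn (by norm_num) x hx).hasDerivWithinAt
  have hd'' : ∀ x ∈ Icc (0 : ℝ) 1, HasDerivWithinAt u' (u'' x) (Icc 0 1) x := fun x hx =>
    (hcu'.differentiableOn (by norm_num) x hx).hasDerivWithinAt
  have hlim : ∀ x ∈ Ico (0 : ℝ) 1,
      Tendsto (fun k : ℕ => -2 * μ k * (2 * 2 ^ k) ^ 2) atTop (𝓝 (u'' x)) := by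
    intro x hx
    have hξ : ∀ k : ℕ, ∃ ξ ∈ Icc (0 : ℝ) 1, |ξ - x| ≤ (1 / 2) ^ k ∧
        u'' ξ = -2 * μ k * (2 * 2 ^ k) ^ 2 := by
      intro k
      have hp : (0 : ℝ) < 2 ^ k := by positivity
      set j := ⌊x * 2 ^ k⌋₊ with hj
      have hx0 : 0 ≤ x * 2 ^ k := mul_nonneg hx.1 hp.le
      have hjx : (j : ℝ) ≤ x * 2 ^ k := Nat.floor_le hx0
      have hxj : x * 2 ^ k < j + 1 := Nat.lt_floor_add_one _
      have hjk : j < 2 ^ k := by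
        rw [hj, Nat.floor_lt hx0]
        push_cast
        nlinarith [hx.2]
      have hjk' : (j : ℝ) + 1 ≤ 2 ^ k := by exact_mod_cast hjk
      have e1 : (j : ℝ) / 2 ^ k + 2 * (1 / (2 * 2 ^ k)) = (j + 1) / 2 ^ k := by field_simp
      have e2 : (j : ℝ) / 2 ^ k + 1 / (2 * 2 ^ k) = (j + 1 / 2) / 2 ^ k := by field_simp
      have b0 : (0 : ℝ) ≤ j / 2 ^ k := by positivity
      have b1 : ((j : ℝ) + 1) / 2 ^ k ≤ 1 := div_le_one_of_le₀ hjk' hp.le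
      obtain ⟨ξ, hξ, hξeq⟩ := exists_second_difference_eq (f := u) (f' := u') (f'' := u'')
        (a := (j : ℝ) / 2 ^ k) (h := 1 / (2 * 2 ^ k)) (by positivity)
        (hu.continuousOn.mono (by rw [e1]; exact Icc_subset_Icc b0 b1))
        (fun y hy => by
          rw [e1] at hy
          have hy' : y ∈ Ioo (0 : ℝ) 1 := Ioo_subset_Ioo b0 b1 hy
          exact (hd' y (Ioo_subset_Icc_self hy')).hasDerivAt (Icc_mem_nhds hy'.1 hy'.2))
        (fun y hy => by
          rw [e1] at hy
          have hy' : y ∈ Ioo (0 : ℝ) 1 := Ioo_subset_Ioo b0 b1 hy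
          exact (hd'' y (Ioo_subset_Icc_self hy')).hasDerivAt (Icc_mem_nhds hy'.1 hy'.2))
      rw [e1, e2, hdiff k j hjk] at hξeq
      rw [e1] at hξ
      refine ⟨ξ, Ioo_subset_Icc_self (Ioo_subset_Ioo b0 b1 hξ), ?_, ?_⟩
      · have c1 : (j : ℝ) / 2 ^ k ≤ x := by rwa [div_le_iff₀ hp]
        have c2 : x ≤ ((j : ℝ) + 1) / 2 ^ k := by rw [le_div_iff₀ hp]; exact hxj.le
        have c3 : ((j : ℝ) + 1) / 2 ^ k = j / 2 ^ k + (1 / 2) ^ k := by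
          rw [add_div, div_pow, one_pow]
        rw [abs_le]
        constructor <;> linarith [hξ.1, hξ.2]
      · rw [hξeq]
        field_simp
    choose ξ hξmem hξx hξeq using hξ
    have ht : Tendsto ξ atTop (𝓝 x) := by
      rw [tendsto_iff_dist_tendsto_zero]
      exact squeeze_zero (fun _ => dist_nonneg) hξx
        (tendsto_pow_atTop_nhds_zero_of_lt_one (by norm_num) (by norm_num))
    have := (hcu''.continuousOn x (Ico_subset_Icc_self hx)).tendsto.comp
      (tendsto_nhdsWithin_iff.mpr ⟨ht, Eventually.of_forall hξmem⟩)
    exact this.congr hξeq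
  exact ⟨u'' 0 / 2, u' 0, u 0, quadratic_of_second_derivative_const hd' hd'' fun x hx =>
    tendsto_nhds_unique (hlim x hx) (hlim 0 ⟨le_rfl, zero_lt_one⟩)⟩
end

section
/- For every integer L ≥ 0, sup_{(x,y) ∈ [−1,1]²} |m_{L+2}(x, y) − x·y| = 2^{−2(L+1)}; that is, |m_{L+2}(x, y) − x·y| ≤ 2^{−2(L+1)} for all (x, y) ∈ [−1,1]², and there exists (x, y) ∈ [−1,1]² for which |m_{L+2}(x, y) − x·y| = 2^{−2(L+1)}. -/
/-- `ŝ_L(x) = |x| − Σ_{ℓ=1}^{L−1} 2^{−2ℓ} g_ℓ(|x|)`. -/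
noncomputable def sHat (L : ℕ) (x : ℝ) : ℝ :=
  |x| - ∑ ℓ ∈ Finset.Icc 1 (L-1), (2:ℝ)^(-(2*(ℓ:ℤ))) * hatg^[ℓ] |x|

/-- `m_L(x,y) = 2(ŝ_L((x+y)/2) − ŝ_L(x/2) − ŝ_L(y/2))`. -/
noncomputable def mL (L : ℕ) (x y : ℝ) : ℝ :=
  2 * (sHat L ((x + y)/2) - sHat L (x/2) - sHat L (y/2))

theorem hatg_mem_Icc (x : ℝ) : hatg x ∈ Set.Icc (0:ℝ) 1 := by
  unfold hatg
  split_ifs with h₁ h₂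
  · constructor <;> linarith [h₁.1, h₁.2]
  · constructor <;> linarith [h₂.1, h₂.2]
  · simp

theorem hatg_iterate_mem_Icc {x : ℝ} (hx : x ∈ Set.Icc (0:ℝ) 1) (n : ℕ) :
    hatg^[n] x ∈ Set.Icc (0:ℝ) 1 := by
  cases n with
  | zero => exact hx
  | succ n =>
    rw [Function.iterate_succ_apply']
    exact hatg_mem_Icc _

/-- The quadratic `x - x²` is self-similar under the hat function. -/
theorem sub_sq_sub_hatg {x : ℝ} (hx : x ∈ Set.Icc (0:ℝ) 1) :
    x - x ^ 2 - hatg x / 4 = (hatg x - hatg x ^ 2) / 4 := by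
  unfold hatg
  split_ifs with h₁ h₂
  · ring
  · ring
  · exact absurd ⟨lt_of_not_ge fun h => h₁ ⟨hx.1, h⟩, hx.2⟩ h₂

theorem sHat_succ_sub_sq (n : ℕ) {x : ℝ} (hx : |x| ≤ 1) :
    sHat (n + 1) x - x ^ 2 = (hatg^[n] |x| - (hatg^[n] |x|) ^ 2) / 4 ^ n := by
  induction n with
  | zero => simp [sHat]
  | succ n ih =>
    have hstep := sub_sq_sub_hatg (hatg_iterate_mem_Icc ⟨abs_nonneg x, hx⟩ n)
    have hpow : (2:ℝ) ^ (-(2 * ((n + 1 : ℕ) : ℤ))) = 1 / (4 ^ n * 4) := by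
      rw [zpow_neg, zpow_mul, zpow_natCast, pow_succ]
      norm_num
    have hs : sHat (n + 1 + 1) x =
        sHat (n + 1) x - 1 / (4 ^ n * 4) * hatg (hatg^[n] |x|) := by
      simp only [sHat, Nat.add_sub_cancel]
      rw [Finset.sum_Icc_succ_top (by omega), hpow, Function.iterate_succ_apply']
      ring
    rw [Function.iterate_succ_apply', hs, pow_succ]
    linear_combination ih + hstep / 4 ^ n

theorem sHat_succ_sub_sq_mem_Icc (n : ℕ) {x : ℝ} (hx : |x| ≤ 1) :
    sHat (n + 1) x - x ^ 2 ∈ Set.Icc (0:ℝ) (1 / 4 / 4 ^ n) := by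
  rw [sHat_succ_sub_sq n hx]
  obtain ⟨h₀, h₁⟩ := hatg_iterate_mem_Icc ⟨abs_nonneg x, hx⟩ n
  constructor
  · exact div_nonneg (by nlinarith) (by positivity)
  · gcongr
    nlinarith [sq_nonneg (hatg^[n] |x| - 1 / 2)]

theorem hatg_iterate_div_two_pow (n : ℕ) {t : ℝ} (ht : t ∈ Set.Icc (0:ℝ) 1) :
    hatg^[n] (t / 2 ^ n) = t := by
  induction n with
  | zero => simp
  | succ n ih =>
    have hle : t / 2 ^ n ≤ 1 := div_le_one_of_le₀ (ht.2.trans (one_le_pow₀ (by norm_num)))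
      (by positivity)
    have hnn : 0 ≤ t / 2 ^ n := div_nonneg ht.1 (by positivity)
    have heq : t / 2 ^ (n + 1) = t / 2 ^ n / 2 := by rw [pow_succ, div_div]
    have hg : hatg (t / 2 ^ n / 2) = t / 2 ^ n := by
      rw [hatg, if_pos ⟨by linarith, by linarith⟩]
      ring
    rw [Function.iterate_succ_apply, heq, hg, ih]

theorem mL_sub_mul (L : ℕ) (x y : ℝ) :
    mL L x y - x * y = 2 * ((sHat L ((x + y) / 2) - ((x + y) / 2) ^ 2) -
      (sHat L (x / 2) - (x / 2) ^ 2) - (sHat L (y / 2) - (y / 2) ^ 2)) := by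
  unfold mL
  ring

theorem stmt9 (L : ℕ) :
    (∀ x ∈ Set.Icc (-1:ℝ) 1, ∀ y ∈ Set.Icc (-1:ℝ) 1,
      |mL (L+2) x y - x * y| ≤ (2:ℝ)^(-(2*((L:ℤ)+1)))) ∧
    (∃ x ∈ Set.Icc (-1:ℝ) 1, ∃ y ∈ Set.Icc (-1:ℝ) 1,
      |mL (L+2) x y - x * y| = (2:ℝ)^(-(2*((L:ℤ)+1)))) := by
  have hpow : (2:ℝ) ^ (-(2 * ((L:ℤ) + 1))) = 1 / 4 ^ (L + 1) := by
    rw [zpow_neg, zpow_mul, ← Nat.cast_succ, zpow_natCast]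
    norm_num
  rw [hpow]
  constructor
  · rintro x ⟨hx₀, hx₁⟩ y ⟨hy₀, hy₁⟩
    obtain ⟨ha₀, ha₁⟩ := sHat_succ_sub_sq_mem_Icc (L + 1) (x := (x + y) / 2)
      (abs_le.2 ⟨by linarith, by linarith⟩)
    obtain ⟨hb₀, hb₁⟩ := sHat_succ_sub_sq_mem_Icc (L + 1) (x := x / 2)
      (abs_le.2 ⟨by linarith, by linarith⟩)
    obtain ⟨hc₀, hc₁⟩ := sHat_succ_sub_sq_mem_Icc (L + 1) (x := y / 2)
      (abs_le.2 ⟨by linarith, by linarith⟩)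
    have hq : (1:ℝ) / 4 / 4 ^ (L + 1) = 1 / 4 ^ (L + 1) / 4 := by ring
    rw [hq] at ha₁ hb₁ hc₁
    rw [mL_sub_mul, abs_le]
    constructor <;> linarith
  · have h₁ : (1:ℝ) / 2 ^ (L + 1) ≤ 1 :=
      div_le_one_of_le₀ (one_le_pow₀ (by norm_num)) (by positivity)
    have h₀ : (0:ℝ) ≤ 1 / 2 ^ (L + 1) := by positivity
    refine ⟨1 / 2 ^ (L + 1), ⟨by linarith, h₁⟩, 1 / 2 ^ (L + 1), ⟨by linarith, h₁⟩, ?_⟩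
    have hfull := sHat_succ_sub_sq (L + 1) (x := 1 / 2 ^ (L + 1)) (by rwa [abs_of_nonneg h₀])
    have hhalf := sHat_succ_sub_sq (L + 1) (x := 1 / 2 / 2 ^ (L + 1))
      (by rw [abs_of_nonneg (by positivity), div_right_comm]; linarith)
    rw [abs_of_nonneg (by positivity), hatg_iterate_div_two_pow _ (by norm_num)] at hfull hhalf
    rw [mL_sub_mul, add_self_div_two, div_right_comm, hfull, hhalf, abs_of_nonpos]
    · ring
    · have : (0:ℝ) < 1 / 4 ^ (L + 1) := by positivity
      ring_nf at this ⊢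
      linarith
end
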